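/- arXiv:1609.07880 — 2 statements merged into one kernel-verified Lean document; each statement's English description precedes it below -/
import Mathlib

section
/- Let (M,J,ξ,η,g) be a compact co-Kähler manifold of dimension 2n+1 with fundamental 2-form ω. The Lefschetz map ℒ^{n−p} : α ↦ ω^{n−p+1} ∧ ι_ξα + ω^{n−p} ∧ η ∧ α restricts to a map Ω^p_η(M) → Ω^{2n+1−p}_η(M) for 0 ≤ p ≤ n which sends closed forms to closed forms and exact forms to exact forms; hence ℒ^{n−p} descends to a map on the cohomology H^*_η(M) ≅ H^*(M;ℝ). -/
/-!
Mathlib does not currently provide differential forms nor the de Rham complex of a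
smooth manifold, let alone almost contact metric / co-Kähler geometry.  We therefore
work with a faithful algebraic model of the de Rham algebra `Ω^*(M;ℝ)` of a smooth
manifold: a ℤ-graded, graded-commutative differential ℝ-algebra, concentrated in
non-negative degrees and generated in degrees `0` and `1` (as the de Rham algebra of a
smooth manifold is, by the Whitney embedding theorem).  The operators and
distinguished forms coming from a co-Kähler structure `(J, ξ, η, g)` on a
`(2n+1)`-dimensional manifold `M` are recorded through the properties they satisfy:
the contraction `ι_ξ` with the Reeb field `ξ`, the (parallel, closed) `1`-form `η`
with `ι_ξ η = 1`, and the (closed) fundamental `2`-form `ω = g(J·,·)` with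
`ι_ξ ω = 0`.  The Lie derivative `L_ξ` is given by Cartan's magic formula
`L_ξ = d ∘ ι_ξ + ι_ξ ∘ d`.
-/

universe u

variable {A : Type u} [Ring A] [Algebra ℝ A]

/-- An algebraic model of the de Rham algebra of a smooth manifold: a ℤ-graded,
graded-commutative differential ℝ-algebra `A`, concentrated in non-negative degrees
and generated (as an ℝ-algebra) in degrees `0` and `1`, with a degree `+1`
differential `d` satisfying `d ∘ d = 0` and the graded Leibniz rule. -/
structure IsDeRhamAlgebra (grade : ℤ → Submodule ℝ A) (d : A →ₗ[ℝ] A) : Prop where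
  isInternal : DirectSum.IsInternal grade
  grade_neg : ∀ p : ℤ, p < 0 → grade p = ⊥
  one_mem : (1 : A) ∈ grade 0
  mul_mem : ∀ {p q : ℤ} {a b : A}, a ∈ grade p → b ∈ grade q → a * b ∈ grade (p + q)
  gcomm : ∀ {p q : ℤ} {a b : A}, a ∈ grade p → b ∈ grade q →
    a * b = ((-1 : ℝ) ^ (p * q)) • (b * a)
  generated : Algebra.adjoin ℝ ((grade 0 : Set A) ∪ (grade 1 : Set A)) = ⊤
  d_mem : ∀ {p : ℤ} {a : A}, a ∈ grade p → d a ∈ grade (p + 1)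
  d_squared : ∀ a : A, d (d a) = 0
  d_leibniz : ∀ {p : ℤ} {a b : A}, a ∈ grade p →
    d (a * b) = d a * b + ((-1 : ℝ) ^ p) • (a * d b)

/-- Closed `p`-forms. -/
def dRCocycles (grade : ℤ → Submodule ℝ A) (d : A →ₗ[ℝ] A) (p : ℤ) : Submodule ℝ A :=
  grade p ⊓ LinearMap.ker d

/-- Exact `p`-forms. -/
def dRBoundaries (grade : ℤ → Submodule ℝ A) (d : A →ₗ[ℝ] A) (p : ℤ) : Submodule ℝ A :=
  (grade (p - 1)).map d

/-- The de Rham cohomology `H^p(M;ℝ)` of the model. -/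
abbrev dRH (grade : ℤ → Submodule ℝ A) (d : A →ₗ[ℝ] A) (p : ℤ) :=
  dRCocycles grade d p ⧸
    ((dRBoundaries grade d p).comap (dRCocycles grade d p).subtype)

/-- An algebraic model of (the de Rham algebra of) a co-Kähler manifold
`(M^{2n+1}, J, ξ, η, g)`:  a de Rham algebra vanishing above the dimension `2n+1`,
together with the contraction operator `iota = ι_ξ` (an odd derivation of degree `-1`
squaring to zero), the closed `1`-form `η` with `η(ξ) = ι_ξ η = 1`, and the closed
fundamental `2`-form `ω` with `ι_ξ ω = 0`.  (The Riemannian metric `g` and the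
parallel `(1,1)`-tensor `J` of the co-Kähler structure enter the model only through
these operators and the properties recorded here.) -/
structure IsCoKahlerModel (n : ℕ) (grade : ℤ → Submodule ℝ A)
    (d iota : A →ₗ[ℝ] A) (η ω : A) : Prop where
  toIsDeRhamAlgebra : IsDeRhamAlgebra grade d
  grade_top : ∀ p : ℤ, 2 * n + 1 < p → grade p = ⊥
  iota_mem : ∀ {p : ℤ} {a : A}, a ∈ grade p → iota a ∈ grade (p - 1)
  iota_iota : ∀ a : A, iota (iota a) = 0
  iota_leibniz : ∀ {p : ℤ} {a b : A}, a ∈ grade p →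
    iota (a * b) = iota a * b + ((-1 : ℝ) ^ p) • (a * iota b)
  eta_mem : η ∈ grade 1
  omega_mem : ω ∈ grade 2
  d_eta : d η = 0
  d_omega : d ω = 0
  iota_eta : iota η = 1
  iota_omega : iota ω = 0

/-- Properties of the model reflecting compactness (and orientability) of the
underlying `(2n+1)`-dimensional co-Kähler manifold: by Hodge theory its de Rham
cohomology is finite-dimensional, and it satisfies Poincaré duality. -/
structure IsCompactCoKahlerModel (n : ℕ) (grade : ℤ → Submodule ℝ A)
    (d iota : A →ₗ[ℝ] A) (η ω : A) : Prop where
  toIsCoKahlerModel : IsCoKahlerModel n grade d iota η ω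
  finiteDimensional : ∀ p : ℤ, FiniteDimensional ℝ (dRH grade d p)
  poincare_duality : ∀ p : ℤ,
    Module.finrank ℝ (dRH grade d p) = Module.finrank ℝ (dRH grade d (2 * n + 1 - p))

/-- The Lie derivative `L_ξ = d ∘ ι_ξ + ι_ξ ∘ d` (Cartan's magic formula). -/
def lieDeriv (d iota : A →ₗ[ℝ] A) : A →ₗ[ℝ] A := d ∘ₗ iota + iota ∘ₗ d

/-- `Ω^p_η(M) = {ν ∈ Ω^p(M;ℝ) | L_ξ ν = 0}`. -/
def etaForms (grade : ℤ → Submodule ℝ A) (d iota : A →ₗ[ℝ] A) (p : ℤ) : Submodule ℝ A :=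
  grade p ⊓ LinearMap.ker (lieDeriv d iota)

/-- Closed forms in `Ω^p_η(M)`. -/
def etaCocycles (grade : ℤ → Submodule ℝ A) (d iota : A →ₗ[ℝ] A) (p : ℤ) : Submodule ℝ A :=
  etaForms grade d iota p ⊓ LinearMap.ker d

/-- Exact forms `d(Ω^{p-1}_η(M))`. -/
def etaBoundaries (grade : ℤ → Submodule ℝ A) (d iota : A →ₗ[ℝ] A) (p : ℤ) : Submodule ℝ A :=
  (etaForms grade d iota (p - 1)).map d

/-- `H^p_η(M)`, the cohomology of the sub-cdga `(Ω^*_η(M), d)`. -/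
abbrev etaH (grade : ℤ → Submodule ℝ A) (d iota : A →ₗ[ℝ] A) (p : ℤ) :=
  etaCocycles grade d iota p ⧸
    ((etaBoundaries grade d iota p).comap (etaCocycles grade d iota p).subtype)

/-- `Ω^p_1(M) = {α ∈ Ω^p_η(M) | ι_ξ α = 0}`. -/
def oneForms (grade : ℤ → Submodule ℝ A) (d iota : A →ₗ[ℝ] A) (p : ℤ) : Submodule ℝ A :=
  etaForms grade d iota p ⊓ LinearMap.ker iota

/-- Closed forms in `Ω^p_1(M)`. -/
def oneCocycles (grade : ℤ → Submodule ℝ A) (d iota : A →ₗ[ℝ] A) (p : ℤ) : Submodule ℝ A :=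
  oneForms grade d iota p ⊓ LinearMap.ker d

/-- Exact forms `d(Ω^{p-1}_1(M))`. -/
def oneBoundaries (grade : ℤ → Submodule ℝ A) (d iota : A →ₗ[ℝ] A) (p : ℤ) : Submodule ℝ A :=
  (oneForms grade d iota (p - 1)).map d

/-- `H^p_1(M)`, the cohomology of the sub-cdga `(Ω^*_1(M), d)`. -/
abbrev oneH (grade : ℤ → Submodule ℝ A) (d iota : A →ₗ[ℝ] A) (p : ℤ) :=
  oneCocycles grade d iota p ⧸
    ((oneBoundaries grade d iota p).comap (oneCocycles grade d iota p).subtype)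

/-- The basic `p`-forms `Ω^p(M, F_ξ) = {α | ι_ξ α = 0, ι_ξ (dα) = 0}` of the
characteristic foliation `F_ξ` spanned by `ξ` (contraction with any vector field
`f·ξ` tangent to `F_ξ` is `f ∧ ι_ξ`, so it suffices to contract with `ξ` itself). -/
def basicForms (grade : ℤ → Submodule ℝ A) (d iota : A →ₗ[ℝ] A) (p : ℤ) : Submodule ℝ A :=
  (grade p ⊓ LinearMap.ker iota) ⊓ Submodule.comap d (LinearMap.ker iota)

/-- Closed basic `p`-forms. -/
def basicCocycles (grade : ℤ → Submodule ℝ A) (d iota : A →ₗ[ℝ] A) (p : ℤ) : Submodule ℝ A :=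
  basicForms grade d iota p ⊓ LinearMap.ker d

/-- Exact basic `p`-forms. -/
def basicBoundaries (grade : ℤ → Submodule ℝ A) (d iota : A →ₗ[ℝ] A) (p : ℤ) : Submodule ℝ A :=
  (basicForms grade d iota (p - 1)).map d

/-- The basic cohomology `H^p(M, F_ξ)` of the characteristic foliation. -/
abbrev basicH (grade : ℤ → Submodule ℝ A) (d iota : A →ₗ[ℝ] A) (p : ℤ) :=
  basicCocycles grade d iota p ⧸
    ((basicBoundaries grade d iota p).comap (basicCocycles grade d iota p).subtype)

/-- The Lefschetz map `ℒ^{n-p} : α ↦ ω^{n-p+1} ∧ ι_ξ α + ω^{n-p} ∧ η ∧ α`. -/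
def lefschetz (iota : A →ₗ[ℝ] A) (η ω : A) (n p : ℕ) (a : A) : A :=
  ω ^ (n - p + 1) * iota a + ω ^ (n - p) * (η * a)

section helpers

variable {n : ℕ} {grade : ℤ → Submodule ℝ A} {d iota : A →ₗ[ℝ] A} {η ω : A}

theorem d_omega_pow (h : IsCoKahlerModel n grade d iota η ω) (k : ℕ) (x : A) :
    d (ω ^ k * x) = ω ^ k * d x := by
  induction k generalizing x with
  | zero => simp
  | succ k ih =>
    rw [pow_succ, mul_assoc, ih, h.toIsDeRhamAlgebra.d_leibniz h.omega_mem, h.d_omega, mul_assoc]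
    norm_num

theorem iota_omega_pow (h : IsCoKahlerModel n grade d iota η ω) (k : ℕ) (x : A) :
    iota (ω ^ k * x) = ω ^ k * iota x := by
  induction k generalizing x with
  | zero => simp
  | succ k ih =>
    rw [pow_succ, mul_assoc, ih, h.iota_leibniz h.omega_mem, h.iota_omega, mul_assoc]
    norm_num

theorem d_eta_mul (h : IsCoKahlerModel n grade d iota η ω) (x : A) :
    d (η * x) = - (η * d x) := by
  rw [h.toIsDeRhamAlgebra.d_leibniz h.eta_mem, h.d_eta]
  simp

theorem iota_eta_mul (h : IsCoKahlerModel n grade d iota η ω) (x : A) :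
    iota (η * x) = x - η * iota x := by
  rw [h.iota_leibniz h.eta_mem, h.iota_eta]
  simp [sub_eq_add_neg]

theorem omega_pow_mem (h : IsCoKahlerModel n grade d iota η ω) (k : ℕ) :
    ω ^ k ∈ grade (2 * k) := by
  induction k with
  | zero => simpa using h.toIsDeRhamAlgebra.one_mem
  | succ k ih =>
    have := h.toIsDeRhamAlgebra.mul_mem ih h.omega_mem
    rw [pow_succ]
    convert this using 2
    push_cast
    ring

/-- The Lefschetz operator with an arbitrary exponent, as a linear map. -/
def lefLin (iota : A →ₗ[ℝ] A) (η ω : A) (k : ℕ) : A →ₗ[ℝ] A :=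
  LinearMap.mulLeft ℝ (ω ^ (k + 1)) ∘ₗ iota +
    LinearMap.mulLeft ℝ (ω ^ k) ∘ₗ LinearMap.mulLeft ℝ η

theorem lefLin_apply (k : ℕ) (a : A) :
    lefLin iota η ω k a = ω ^ (k + 1) * iota a + ω ^ k * (η * a) := rfl

theorem d_lefLin (h : IsCoKahlerModel n grade d iota η ω) (k : ℕ) {a : A}
    (ha : lieDeriv d iota a = 0) :
    d (lefLin iota η ω k a) = - lefLin iota η ω k (d a) := by
  have ha' : d (iota a) = - iota (d a) := eq_neg_of_add_eq_zero_left ha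
  rw [lefLin_apply, lefLin_apply, map_add, d_omega_pow h, d_omega_pow h, d_eta_mul h, ha']
  noncomm_ring

theorem lie_d (h : IsCoKahlerModel n grade d iota η ω) {a : A}
    (ha : lieDeriv d iota a = 0) : lieDeriv d iota (d a) = 0 := by
  have ha' : d (iota a) = - iota (d a) := eq_neg_of_add_eq_zero_left ha
  have h2 : iota (d a) = - d (iota a) := by rw [ha', neg_neg]
  change d (iota (d a)) + iota (d (d a)) = 0
  rw [h2, map_neg, h.toIsDeRhamAlgebra.d_squared, h.toIsDeRhamAlgebra.d_squared]
  simp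

theorem iota_lefLin (h : IsCoKahlerModel n grade d iota η ω) (k : ℕ) (a : A) :
    iota (lefLin iota η ω k a) = ω ^ k * (a - η * iota a) := by
  rw [lefLin_apply, map_add, iota_omega_pow h, iota_omega_pow h, iota_eta_mul h, h.iota_iota]
  simp

theorem lie_lefLin (h : IsCoKahlerModel n grade d iota η ω) (k : ℕ) {a : A}
    (ha : lieDeriv d iota a = 0) : lieDeriv d iota (lefLin iota η ω k a) = 0 := by
  have ha' : d (iota a) = - iota (d a) := eq_neg_of_add_eq_zero_left ha
  change d (iota (lefLin iota η ω k a)) + iota (d (lefLin iota η ω k a)) = 0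
  rw [d_lefLin h k ha, map_neg, iota_lefLin h, iota_lefLin h, d_omega_pow h, map_sub,
    d_eta_mul h, ha']
  noncomm_ring

theorem lefLin_mem_grade (h : IsCoKahlerModel n grade d iota η ω) (k : ℕ) {q r : ℤ} {a : A}
    (ha : a ∈ grade q) (hr : r = 2 * k + 1 + q) : lefLin iota η ω k a ∈ grade r := by
  subst hr
  rw [lefLin_apply]
  have hD := h.toIsDeRhamAlgebra
  refine add_mem ?_ ?_
  · have := hD.mul_mem (omega_pow_mem h (k + 1)) (h.iota_mem ha)
    convert this using 2
    push_cast
    ring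
  · have := hD.mul_mem (omega_pow_mem h k) (hD.mul_mem h.eta_mem ha)
    convert this using 2
    ring

theorem lefLin_mem_etaForms (h : IsCoKahlerModel n grade d iota η ω) (k : ℕ) {q r : ℤ} {a : A}
    (ha : a ∈ etaForms grade d iota q) (hr : r = 2 * k + 1 + q) :
    lefLin iota η ω k a ∈ etaForms grade d iota r :=
  ⟨lefLin_mem_grade h k ha.1 hr, lie_lefLin h k ha.2⟩

theorem lefLin_mem_etaCocycles (h : IsCoKahlerModel n grade d iota η ω) (k : ℕ) {q r : ℤ} {a : A}
    (ha : a ∈ etaCocycles grade d iota q) (hr : r = 2 * k + 1 + q) :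
    lefLin iota η ω k a ∈ etaCocycles grade d iota r := by
  refine ⟨lefLin_mem_etaForms h k ha.1 hr, ?_⟩
  have hda : d a = 0 := ha.2
  change d _ = 0
  rw [d_lefLin h k ha.1.2, hda, map_zero, neg_zero]

theorem lefLin_mem_etaBoundaries (h : IsCoKahlerModel n grade d iota η ω) (k : ℕ) {q r : ℤ}
    {a : A} (ha : a ∈ etaBoundaries grade d iota q) (hr : r = 2 * k + 1 + q) :
    lefLin iota η ω k a ∈ etaBoundaries grade d iota r := by
  obtain ⟨b, hb, rfl⟩ := ha
  refine ⟨- lefLin iota η ω k b, neg_mem (lefLin_mem_etaForms h k hb (by rw [hr]; ring)), ?_⟩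
  rw [map_neg, d_lefLin h k hb.2, neg_neg]

end helpers

/-- Let `(M, J, ξ, η, g)` be a compact co-Kähler manifold of dimension
`2n+1` with fundamental `2`-form `ω`.  The Lefschetz map
`ℒ^{n-p} : α ↦ ω^{n-p+1} ∧ ι_ξ α + ω^{n-p} ∧ η ∧ α` restricts to a map
`Ω^p_η(M) → Ω^{2n+1-p}_η(M)` for `0 ≤ p ≤ n`, which sends closed forms to closed forms
and exact forms to exact forms; hence `ℒ^{n-p}` descends to a map on the cohomology
`H^*_η(M) ≅ H^*(M;ℝ)`. -/
theorem lefschetz_restricts_and_descends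
    {A : Type u} [Ring A] [Algebra ℝ A] (n : ℕ)
    (grade : ℤ → Submodule ℝ A) (d iota : A →ₗ[ℝ] A) (η ω : A)
    (hM : IsCompactCoKahlerModel n grade d iota η ω)
    (p : ℕ) (hp : p ≤ n) :
    -- `ℒ^{n-p}` maps `Ω^p_η(M)` into `Ω^{2n+1-p}_η(M)`:
    (∀ a : A, a ∈ etaForms grade d iota p →
      lefschetz iota η ω n p a ∈ etaForms grade d iota (2 * n + 1 - p)) ∧
    -- it sends closed forms to closed forms:
    (∀ a : A, a ∈ etaCocycles grade d iota p →
      lefschetz iota η ω n p a ∈ etaCocycles grade d iota (2 * n + 1 - p)) ∧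
    -- it sends exact forms to exact forms:
    (∀ a : A, a ∈ etaBoundaries grade d iota p →
      lefschetz iota η ω n p a ∈ etaBoundaries grade d iota (2 * n + 1 - p)) ∧
    -- hence it descends to a map on cohomology `H^p_η(M) → H^{2n+1-p}_η(M)`:
    (∃ F : etaH grade d iota p →ₗ[ℝ] etaH grade d iota (2 * n + 1 - p),
      ∀ (a : A) (ha : a ∈ etaCocycles grade d iota p),
        ∃ hb : lefschetz iota η ω n p a ∈ etaCocycles grade d iota (2 * n + 1 - p),
          F (Submodule.Quotient.mk ⟨a, ha⟩) =
            Submodule.Quotient.mk ⟨lefschetz iota η ω n p a, hb⟩) := by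
  have h := hM.toIsCoKahlerModel
  have hr : (2 * n + 1 - p : ℤ) = 2 * ((n - p : ℕ) : ℤ) + 1 + p := by
    push_cast [hp]
    ring
  refine ⟨fun a ha => lefLin_mem_etaForms h (n - p) ha hr,
    fun a ha => lefLin_mem_etaCocycles h (n - p) ha hr,
    fun a ha => lefLin_mem_etaBoundaries h (n - p) ha hr, ?_⟩
  refine ⟨Submodule.mapQ _ _ ((lefLin iota η ω (n - p)).restrict
    (fun a ha => lefLin_mem_etaCocycles h (n - p) ha hr)) ?_, ?_⟩
  · intro x hx
    exact lefLin_mem_etaBoundaries h (n - p) hx hr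
  · intro a ha
    exact ⟨lefLin_mem_etaCocycles h (n - p) ha hr, rfl⟩
end

section
/- Let (M,J,ξ,η,g) be a compact co-Kähler manifold. Then the cohomology H^p_η(M) of the cdga Ω^*_η(M) splits as H^p_η(M) = H^p_1(M) ⊕ [η] ∧ H^{p−1}_1(M), where H^*_1(M) is the cohomology of the differential subalgebra Ω^*_1(M); in particular, the cohomology of Ω^*_η(M) depends only on the cohomology of Ω^*_1(M). -/
/-!
Mathlib does not currently provide differential forms nor the de Rham complex of a
smooth manifold, let alone almost contact metric / co-Kähler geometry.  We therefore
work with a faithful algebraic model of the de Rham algebra `Ω^*(M;ℝ)` of a smooth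
manifold: a ℤ-graded, graded-commutative differential ℝ-algebra, concentrated in
non-negative degrees and generated in degrees `0` and `1` (as the de Rham algebra of a
smooth manifold is, by the Whitney embedding theorem).  The operators and
distinguished forms coming from a co-Kähler structure `(J, ξ, η, g)` on a
`(2n+1)`-dimensional manifold `M` are recorded through the properties they satisfy:
the contraction `ι_ξ` with the Reeb field `ξ`, the (parallel, closed) `1`-form `η`
with `ι_ξ η = 1`, and the (closed) fundamental `2`-form `ω = g(J·,·)` with
`ι_ξ ω = 0`.  The Lie derivative `L_ξ` is given by Cartan's magic formula
`L_ξ = d ∘ ι_ξ + ι_ξ ∘ d`.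
-/

universe u

variable {A : Type u} [Ring A] [Algebra ℝ A]

/-- Membership in `Ω^p_η`. -/
theorem mem_etaForms_iff (grade : ℤ → Submodule ℝ A) (d iota : A →ₗ[ℝ] A) (p : ℤ) (a : A) :
    a ∈ etaForms grade d iota p ↔ a ∈ grade p ∧ d (iota a) + iota (d a) = 0 := by
  simp [etaForms, lieDeriv]

/-- Membership in the cocycles of `Ω^p_η`. -/
theorem mem_etaCocycles_iff (grade : ℤ → Submodule ℝ A) (d iota : A →ₗ[ℝ] A) (p : ℤ) (a : A) :
    a ∈ etaCocycles grade d iota p ↔ a ∈ grade p ∧ d (iota a) = 0 ∧ d a = 0 := by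
  simp only [etaCocycles, Submodule.mem_inf, mem_etaForms_iff, LinearMap.mem_ker]
  constructor
  · rintro ⟨⟨h1, h2⟩, h3⟩
    refine ⟨h1, ?_, h3⟩
    simpa [h3] using h2
  · rintro ⟨h1, h2, h3⟩
    exact ⟨⟨h1, by simp [h2, h3]⟩, h3⟩

/-- Membership in `Ω^p_1`. -/
theorem mem_oneForms_iff (grade : ℤ → Submodule ℝ A) (d iota : A →ₗ[ℝ] A) (p : ℤ) (a : A) :
    a ∈ oneForms grade d iota p ↔ a ∈ grade p ∧ iota (d a) = 0 ∧ iota a = 0 := by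
  simp only [oneForms, Submodule.mem_inf, mem_etaForms_iff, LinearMap.mem_ker]
  constructor
  · rintro ⟨⟨h1, h2⟩, h3⟩
    refine ⟨h1, ?_, h3⟩
    simpa [h3] using h2
  · rintro ⟨h1, h2, h3⟩
    exact ⟨⟨h1, by simp [h2, h3]⟩, h3⟩

/-- Membership in the cocycles of `Ω^p_1`. -/
theorem mem_oneCocycles_iff (grade : ℤ → Submodule ℝ A) (d iota : A →ₗ[ℝ] A) (p : ℤ) (a : A) :
    a ∈ oneCocycles grade d iota p ↔ a ∈ grade p ∧ iota a = 0 ∧ d a = 0 := by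
  simp only [oneCocycles, Submodule.mem_inf, mem_oneForms_iff, LinearMap.mem_ker]
  constructor
  · rintro ⟨⟨h1, h2, h3⟩, h4⟩
    exact ⟨h1, h3, h4⟩
  · rintro ⟨h1, h2, h3⟩
    exact ⟨⟨h1, by simp [h3], h2⟩, h3⟩

/-- Let `(M, J, ξ, η, g)` be a compact co-Kähler manifold.  Then the
cohomology `H^p_η(M)` of the cdga `Ω^*_η(M)` splits as
`H^p_η(M) = H^p_1(M) ⊕ [η] ∧ H^{p-1}_1(M)`, where `H^*_1(M)` is the cohomology of the
differential subalgebra `Ω^*_1(M)`; in particular, the cohomology of `Ω^*_η(M)`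
depends only on the cohomology of `Ω^*_1(M)`.

The splitting is realized by the isomorphism `(α, β) ↦ [α] + [η] ∧ [β]` from
`H^p_1(M) ⊕ H^{p-1}_1(M)` to `H^p_η(M)`. -/
theorem etaH_splits
    {A : Type u} [Ring A] [Algebra ℝ A] (n : ℕ)
    (grade : ℤ → Submodule ℝ A) (d iota : A →ₗ[ℝ] A) (η ω : A)
    (hM : IsCompactCoKahlerModel n grade d iota η ω) :
    ∀ p : ℤ,
      ∃ F : (oneH grade d iota p × oneH grade d iota (p - 1)) →ₗ[ℝ] etaH grade d iota p,
        Function.Bijective F ∧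
        ∀ (a b : A) (ha : a ∈ oneCocycles grade d iota p)
          (hb : b ∈ oneCocycles grade d iota (p - 1)),
          ∃ hab : a + η * b ∈ etaCocycles grade d iota p,
            F (Submodule.Quotient.mk ⟨a, ha⟩, Submodule.Quotient.mk ⟨b, hb⟩) =
              Submodule.Quotient.mk ⟨a + η * b, hab⟩ := by
  intro p
  have hC := hM.toIsCoKahlerModel
  have hR := hC.toIsDeRhamAlgebra
  have dη : ∀ b : A, d (η * b) = -(η * d b) := by
    intro b
    rw [hR.d_leibniz hC.eta_mem, hC.d_eta]
    simp
  have iη : ∀ b : A, iota (η * b) = b - η * iota b := by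
    intro b
    rw [hC.iota_leibniz hC.eta_mem, hC.iota_eta]
    simp [sub_eq_add_neg]
  have gη : ∀ {q : ℤ} {b : A}, b ∈ grade (q - 1) → η * b ∈ grade q := by
    intro q b hb
    have := hR.mul_mem hC.eta_mem hb
    rwa [add_sub_cancel] at this
  have h1 : ∀ a ∈ oneCocycles grade d iota p, a ∈ etaCocycles grade d iota p := by
    intro a ha
    rw [mem_oneCocycles_iff] at ha
    rw [mem_etaCocycles_iff]
    exact ⟨ha.1, by simp [ha.2.1], ha.2.2⟩
  have h2 : ∀ b ∈ oneCocycles grade d iota (p - 1), η * b ∈ etaCocycles grade d iota p := by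
    intro b hb
    rw [mem_oneCocycles_iff] at hb
    rw [mem_etaCocycles_iff]
    exact ⟨gη hb.1, by simp [iη, hb.2.1, hb.2.2], by simp [dη, hb.2.2]⟩
  let f1 : oneCocycles grade d iota p →ₗ[ℝ] etaCocycles grade d iota p :=
    Submodule.inclusion h1
  let f2 : oneCocycles grade d iota (p - 1) →ₗ[ℝ] etaCocycles grade d iota p :=
    (LinearMap.mulLeft ℝ η).restrict h2
  have hf1 : ((oneBoundaries grade d iota p).comap (oneCocycles grade d iota p).subtype) ≤
      ((etaBoundaries grade d iota p).comap (etaCocycles grade d iota p).subtype).comap f1 := by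
    rintro ⟨a, ha⟩ ⟨x, hx, hxa⟩
    exact ⟨x, hx.1, hxa⟩
  have hf2 : ((oneBoundaries grade d iota (p - 1)).comap
        (oneCocycles grade d iota (p - 1)).subtype) ≤
      ((etaBoundaries grade d iota p).comap (etaCocycles grade d iota p).subtype).comap f2 := by
    rintro ⟨b, hb⟩ ⟨x, hx, hxb⟩
    have hxb' : d x = b := hxb
    have hx' := (mem_oneForms_iff grade d iota (p - 1 - 1) x).1 hx
    refine ⟨-(η * x), ?_, ?_⟩
    · refine (mem_etaForms_iff grade d iota (p - 1) _).2 ⟨neg_mem (gη hx'.1), ?_⟩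
      simp [iη, dη, hx'.2.1, hx'.2.2]
    · change d (-(η * x)) = η * b
      simp [dη, hxb']
  let F := (Submodule.mapQ _ _ f1 hf1).coprod (Submodule.mapQ _ _ f2 hf2)
  have hF : ∀ (a b : A) (ha : a ∈ oneCocycles grade d iota p)
          (hb : b ∈ oneCocycles grade d iota (p - 1)),
            F (Submodule.Quotient.mk ⟨a, ha⟩, Submodule.Quotient.mk ⟨b, hb⟩) =
              Submodule.Quotient.mk ⟨a + η * b, add_mem (h1 a ha) (h2 b hb)⟩ := by
    intro a b ha hb
    rfl
  refine ⟨F, ⟨?_, ?_⟩, fun a b ha hb => ⟨add_mem (h1 a ha) (h2 b hb), hF a b ha hb⟩⟩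
  · rw [injective_iff_map_eq_zero]
    rintro ⟨x, y⟩ hxy
    obtain ⟨⟨a, ha⟩, rfl⟩ := Submodule.Quotient.mk_surjective _ x
    obtain ⟨⟨b, hb⟩, rfl⟩ := Submodule.Quotient.mk_surjective _ y
    rw [hF, Submodule.Quotient.mk_eq_zero] at hxy
    obtain ⟨ν, hν, hν'⟩ := hxy
    have e : d ν = a + η * b := hν'
    have ha' := (mem_oneCocycles_iff grade d iota p a).1 ha
    have hb' := (mem_oneCocycles_iff grade d iota (p - 1) b).1 hb
    obtain ⟨hνg, hνL⟩ := (mem_etaForms_iff grade d iota (p - 1) ν).1 hν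
    have e2 : iota (d ν) = b := by simp [e, iη, ha'.2.1, hb'.2.1]
    have e3 : d (iota ν) = -b := by
      rw [e2] at hνL
      exact eq_neg_of_add_eq_zero_left hνL
    have e4 : d (ν - η * iota ν) = a := by
      rw [map_sub, dη, e3, e]
      simp
    refine Prod.ext ?_ ?_
    · refine (Submodule.Quotient.mk_eq_zero _).2 ⟨ν - η * iota ν, ?_, e4⟩
      refine (mem_oneForms_iff grade d iota (p - 1) _).2 ⟨?_, ?_, ?_⟩
      · exact sub_mem hνg (gη (hC.iota_mem hνg))
      · rw [e4, ha'.2.1]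
      · simp [iη, hC.iota_iota]
    · refine (Submodule.Quotient.mk_eq_zero _).2 ⟨-iota ν, ?_, ?_⟩
      · refine (mem_oneForms_iff grade d iota (p - 1 - 1) _).2 ⟨?_, ?_, ?_⟩
        · exact neg_mem (hC.iota_mem hνg)
        · simp [e3, hb'.2.1]
        · simp [hC.iota_iota]
      · change d (-iota ν) = b
        simp [e3]
  · intro z
    obtain ⟨⟨ν, hν⟩, rfl⟩ := Submodule.Quotient.mk_surjective _ z
    obtain ⟨hg, hi, hd⟩ := (mem_etaCocycles_iff grade d iota p ν).1 hν
    have hb : iota ν ∈ oneCocycles grade d iota (p - 1) :=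
      (mem_oneCocycles_iff grade d iota (p - 1) _).2 ⟨hC.iota_mem hg, hC.iota_iota ν, hi⟩
    have ha : ν - η * iota ν ∈ oneCocycles grade d iota p :=
      (mem_oneCocycles_iff grade d iota p _).2 ⟨sub_mem hg (gη (hC.iota_mem hg)),
        by simp [iη, hC.iota_iota], by simp [dη, hi, hd]⟩
    refine ⟨(Submodule.Quotient.mk ⟨_, ha⟩, Submodule.Quotient.mk ⟨_, hb⟩), ?_⟩
    rw [hF]
    congr 1
    exact Subtype.ext (sub_add_cancel _ _)
end
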